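/- Let $G$ be a $6$-double-critical graph that is claw-free, and let $xy \in E(G)$. If some vertex of the subgraph of $G$ induced by $N(x) \cap N(y)$ has degree at most $|N(x) \cap N(y)| - 4$ in that induced subgraph, then $G$ is isomorphic to $K_6$. Equivalently, if $G \not\cong K_6$, then the minimum degree of $G[N(x) \cap N(y)]$ is at least $|N(x) \cap N(y)| - 3$. -/

import Mathlib

open SimpleGraph

/-- A connected graph `G` with chromatic number `n` is `n`-double-critical if
deleting the two endpoints of any edge drops the chromatic number to `n - 2`. -/
def DoubleCritical {V : Type*} (G : SimpleGraph V) (n : ℕ) : Prop :=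
  G.Connected ∧ G.chromaticNumber = (n : ℕ∞) ∧
    ∀ x y : V, G.Adj x y →
      (G.induce ({x, y}ᶜ : Set V)).chromaticNumber = ((n - 2 : ℕ) : ℕ∞)

/-- A graph is claw-free if it has no induced `K_{1,3}`. -/
def ClawFree {V : Type*} (G : SimpleGraph V) : Prop :=
  ∀ v a b c : V, G.Adj v a → G.Adj v b → G.Adj v c →
    a ≠ b → a ≠ c → b ≠ c → ¬ G.Adj a b → ¬ G.Adj a c → ¬ G.Adj b c → False

namespace DoubleCritical

variable {V : Type*} {G : SimpleGraph V} {n : ℕ}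

lemma colorable_induce (hG : DoubleCritical G n) {v w : V} (hvw : G.Adj v w) :
    (G.induce ({v, w}ᶜ : Set V)).Colorable (n - 2) :=
  chromaticNumber_le_iff_colorable.1 (hG.2.2 v w hvw).le

/-- A clique avoiding both ends of some edge has at most `n - 2` vertices. -/
lemma card_le_of_isClique (hG : DoubleCritical G n) {v w : V} (hvw : G.Adj v w) {s : Finset V}
    (hs : G.IsClique s) (hv : v ∉ s) (hw : w ∉ s) : s.card ≤ n - 2 := by
  classical
  obtain ⟨C⟩ := hG.colorable_induce hvw
  have hmem (u : s) : u.1 ∈ ({v, w}ᶜ : Set V) := by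
    rintro (h | h)
    · exact hv (h ▸ u.2)
    · exact hw (h ▸ u.2)
  have hinj : Function.Injective fun u : s => C ⟨u, hmem u⟩ := by
    intro p q hpq
    by_contra hne
    exact C.valid (v := ⟨p, hmem p⟩) (w := ⟨q, hmem q⟩)
      (hs p.2 q.2 fun h => hne (Subtype.ext h)) hpq
  simpa using Fintype.card_le_of_injective _ hinj

/-- A vertex `v` adjacent to `x` has a neighbor other than `x` and `y`: otherwise a coloring of
`G - v - x` would extend to `G` using one more color. -/
lemma exists_adj_ne_ne (hG : DoubleCritical G n) (hn : 4 ≤ n) {v x : V} (hvx : G.Adj v x)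
    {y : V} (hyv : y ≠ v) (hyx : y ≠ x) : ∃ w, G.Adj v w ∧ w ≠ x ∧ w ≠ y := by
  classical
  by_contra! hnbr
  obtain ⟨C⟩ := hG.colorable_induce hvx
  have hmem {u : V} (hv : u ≠ v) (hx : u ≠ x) : u ∈ ({v, x}ᶜ : Set V) := by simp [hv, hx]
  have : Nontrivial (Fin (n - 2)) := Fin.nontrivial_iff_two_le.2 (by omega)
  obtain ⟨i, hi⟩ := exists_ne (C ⟨y, hmem hyv hyx⟩)
  let f : V → Option (Fin (n - 2)) := fun u =>
    if hx : u = x then none else if hv : u = v then some i else some (C ⟨u, hmem hv hx⟩)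
  have hvalid : ∀ {p q}, G.Adj p q → f p ≠ f q := by
    intro p q hpq
    have hne := hpq.ne
    by_cases hpx : p = x
    · subst hpx
      by_cases hqv : q = v <;> simp [f, hne.symm, hqv, hvx.ne]
    by_cases hqx : q = x
    · subst hqx
      by_cases hpv : p = v <;> simp [f, hne, hpv, hvx.ne]
    by_cases hpv : p = v
    · subst hpv
      obtain rfl := hnbr q hpq hqx
      simpa [f, hpx, hqx, hyv] using hi
    by_cases hqv : q = v
    · subst hqv
      obtain rfl := hnbr p hpq.symm hpx
      simpa [f, hpx, hqx, hyv] using hi.symm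
    simpa [f, hpx, hqx, hpv, hqv] using
      C.valid (v := ⟨p, hmem hpv hpx⟩) (w := ⟨q, hmem hqv hqx⟩) hpq
  have hle := (Coloring.mk f hvalid).colorable.chromaticNumber_le
  rw [hG.2.1, Nat.cast_le, Fintype.card_option, Fintype.card_fin] at hle
  omega

end DoubleCritical

/-- In a claw-free graph, the non-neighbors in `N(x)` of a vertex `v ∈ N(x)` are pairwise
adjacent. -/
lemma ClawFree.adj_of_not_adj {V : Type*} {G : SimpleGraph V} (hG : ClawFree G) {x v a b : V}
    (hv : G.Adj x v) (ha : G.Adj x a) (hb : G.Adj x b) (hav : a ≠ v) (hbv : b ≠ v) (hab : a ≠ b)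
    (hva : ¬ G.Adj v a) (hvb : ¬ G.Adj v b) : G.Adj a b := by
  by_contra h
  exact hG x v a b hv ha hb hav.symm hbv.symm hab hva hvb h

/-- In a claw-free 6-double-critical graph, if some vertex of the subgraph
induced by $S = N(x) \cap N(y)$ (for an edge $xy$) has degree at most
$|S| - 4$ there, then $G \cong K_6$. -/
theorem stmt_14 {V : Type*} [Fintype V] (G : SimpleGraph V)
    (hdc : DoubleCritical G 6) (hcf : ClawFree G)
    (x y : V) (hxy : G.Adj x y)
    (h : ∃ v : (G.neighborSet x ∩ G.neighborSet y : Set V),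
      ((((G.induce (G.neighborSet x ∩ G.neighborSet y)).neighborSet v).ncard : ℤ)) ≤
        ((G.neighborSet x ∩ G.neighborSet y).ncard : ℤ) - 4) :
    Nonempty (G ≃g (⊤ : SimpleGraph (Fin 6))) := by
  classical
  exfalso
  set S := G.neighborSet x ∩ G.neighborSet y
  obtain ⟨⟨v, hvS⟩, hdeg⟩ := h
  have hvx : G.Adj x v := hvS.1
  have hvy : G.Adj y v := hvS.2
  let N : Set V := insert v (Subtype.val '' (G.induce S).neighborSet ⟨v, hvS⟩)
  have hN : N.ncard ≤ ((G.induce S).neighborSet ⟨v, hvS⟩).ncard + 1 := by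
    refine (Set.ncard_insert_le _ _).trans ?_
    rw [Set.ncard_image_of_injective _ Subtype.val_injective]
  have hcard : 3 ≤ (S \ N).ncard := by
    have := Set.le_ncard_sdiff N S
    omega
  obtain ⟨t, htS, ht⟩ := Set.exists_subset_card_eq hcard
  have hmem : ∀ u ∈ t, G.Adj x u ∧ G.Adj y u ∧ u ≠ v ∧ ¬ G.Adj v u := by
    intro u hu
    obtain ⟨huS, huN⟩ := htS hu
    refine ⟨huS.1, huS.2, fun h => huN (Or.inl h), fun h => huN (Or.inr ⟨⟨u, huS⟩, ?_, rfl⟩)⟩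
    simpa using h
  have htclique : G.IsClique t := by
    intro a ha b hb hab
    obtain ⟨hxa, -, hav, hva⟩ := hmem a ha
    obtain ⟨hxb, -, hbv, hvb⟩ := hmem b hb
    exact hcf.adj_of_not_adj hvx hxa hxb hav hbv hab hva hvb
  have hclique : G.IsClique (insert x (insert y t)) := by
    rw [isClique_insert, isClique_insert]
    refine ⟨⟨htclique, fun u hu _ => (hmem u hu).2.1⟩, ?_⟩
    rintro u (rfl | hu) -
    exacts [hxy, (hmem u hu).1]
  have hyt : y ∉ t := fun h => (hmem y h).2.1.ne rfl
  have hxt : x ∉ insert y t := by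
    rintro (h | h)
    exacts [hxy.ne h, (hmem x h).1.ne rfl]
  obtain ⟨w, hvw, hwx, hwy⟩ := hdc.exists_adj_ne_ne (by norm_num) hvx.symm hvy.ne hxy.ne'
  have hle := hdc.card_le_of_isClique hvw (s := (insert x (insert y t)).toFinset)
    (by simpa using hclique) ?_ ?_
  · rw [← Set.ncard_eq_toFinset_card', Set.ncard_insert_of_notMem hxt,
      Set.ncard_insert_of_notMem hyt, ht] at hle
    omega
  · simp only [Set.mem_toFinset]
    rintro (h | h | h)
    exacts [hvx.ne' h, hvy.ne' h, (hmem v h).2.2.1 rfl]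
  · simp only [Set.mem_toFinset]
    rintro (h | h | h)
    exacts [hwx h, hwy h, (hmem w h).2.2.2 hvw]
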